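/- Theorem 1, version 2 (unbiasedness of locally weighted MCMC with Barker-type weights): for every bounded measurable h : S → ℝ, Σ_{i=0}^{M} ∫_{S^{M+1}} w_i(x) · h(x_i) · q₀(x) dμ^{⊗(M+1)}(x) = ∫_S h(x) π(x) dμ(x). That is, if the current point x₀ is distributed according to π and the proposals x₁, …, x_M are drawn from k(·; x₀), the version 2 weighted estimator Σ_{i=0}^{M} w_i(x) h(x_i) is unbiased for ∫ h π dμ. -/

import Mathlib

open MeasureTheory

/-- `mpQ π k i x = q_i(x) = π(x_i) k(x_{−i}; x_i)`, where `x ∈ S^{M+1}` and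
`x_{−i}` is the vector of the remaining `M` coordinates (in order), and
`k y x` denotes the one-to-M proposal density `k(y₁,…,y_M; x)`. -/
noncomputable def mpQ {S : Type*} {M : ℕ} (π : S → ℝ) (k : (Fin M → S) → S → ℝ)
    (i : Fin (M + 1)) (x : Fin (M + 1) → S) : ℝ :=
  π (x i) * k (fun j => x (i.succAbove j)) (x i)

/-- The version 2 (Barker-type) weights:
`w_i(x) = q_i(x) / Σ_{j=0}^{M} q_j(x)` when `Σ_j q_j(x) > 0`, and
`w_i(x) = 𝟙{i = 0}` otherwise. -/
noncomputable def mpW2 {S : Type*} {M : ℕ} (π : S → ℝ) (k : (Fin M → S) → S → ℝ)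
    (i : Fin (M + 1)) (x : Fin (M + 1) → S) : ℝ :=
  if 0 < ∑ j : Fin (M + 1), mpQ π k j x then
    mpQ π k i x / ∑ j : Fin (M + 1), mpQ π k j x
  else if i = 0 then 1 else 0

/-- Every permutation `σ` of `Fin (M + 1)` induces a permutation of `Fin M` between the
complements of `j` and `σ j`. -/
lemma exists_perm_succAbove {M : ℕ} (σ : Equiv.Perm (Fin (M + 1))) (j : Fin (M + 1)) :
    ∃ τ : Equiv.Perm (Fin M), ∀ m, σ (j.succAbove m) = (σ j).succAbove (τ m) := by
  have hσ : ∀ a, a ≠ j ↔ σ a ≠ σ j := fun a => σ.injective.ne_iff.symm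
  refine ⟨(finSuccAboveEquiv j).trans
    ((σ.subtypeEquiv hσ).trans (finSuccAboveEquiv (σ j)).symm), fun m => ?_⟩
  have key := congrArg Subtype.val ((finSuccAboveEquiv (σ j)).apply_symm_apply
    (σ.subtypeEquiv hσ (finSuccAboveEquiv j m)))
  exact key.symm

lemma mpQ_comp_perm {S : Type*} {M : ℕ} (π : S → ℝ) {k : (Fin M → S) → S → ℝ}
    (hk_symm : ∀ (σ : Equiv.Perm (Fin M)) (y : Fin M → S) (x : S), k (y ∘ σ) x = k y x)
    (σ : Equiv.Perm (Fin (M + 1))) (j : Fin (M + 1)) (x : Fin (M + 1) → S) :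
    mpQ π k j (fun a => x (σ a)) = mpQ π k (σ j) x := by
  obtain ⟨τ, hτ⟩ := exists_perm_succAbove σ j
  unfold mpQ
  simp only [hτ]
  rw [← hk_symm τ (fun m => x ((σ j).succAbove m))]
  rfl

lemma mpQ_nonneg {S : Type*} {M : ℕ} {π : S → ℝ} {k : (Fin M → S) → S → ℝ}
    (hπ : ∀ x, 0 ≤ π x) (hk : ∀ y x, 0 ≤ k y x) (i : Fin (M + 1)) (x : Fin (M + 1) → S) :
    0 ≤ mpQ π k i x :=
  mul_nonneg (hπ _) (hk _ _)

lemma measurable_mpQ {S : Type*} [MeasurableSpace S] {M : ℕ} {π : S → ℝ}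
    {k : (Fin M → S) → S → ℝ} (hπ : Measurable π)
    (hk : Measurable fun p : (Fin M → S) × S => k p.1 p.2) (i : Fin (M + 1)) :
    Measurable (mpQ π k i) := by
  have hpair : Measurable fun x : Fin (M + 1) → S => ((fun j => x (i.succAbove j)), x i) := by
    fun_prop
  exact (hπ.comp (measurable_pi_apply i)).mul (hk.comp hpair)

lemma sum_mpQ_eq_zero_imp {S : Type*} {M : ℕ} {π : S → ℝ} {k : (Fin M → S) → S → ℝ}
    (hπ : ∀ x, 0 ≤ π x) (hk : ∀ y x, 0 ≤ k y x) {x : Fin (M + 1) → S}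
    (hs : ∑ j, mpQ π k j x = 0) (i : Fin (M + 1)) : mpQ π k i x = 0 :=
  (Finset.sum_eq_zero_iff_of_nonneg fun j _ => mpQ_nonneg hπ hk j x).1 hs i (Finset.mem_univ i)

/-- Where all the `mpQ π k j x` vanish, the case split in the weights is irrelevant. -/
lemma mpW2_mul_mpQ {S : Type*} {M : ℕ} {π : S → ℝ} {k : (Fin M → S) → S → ℝ}
    (hπ : ∀ x, 0 ≤ π x) (hk : ∀ y x, 0 ≤ k y x) (i l : Fin (M + 1)) (x : Fin (M + 1) → S) :
    mpW2 π k i x * mpQ π k l x = mpQ π k i x / (∑ j, mpQ π k j x) * mpQ π k l x := by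
  unfold mpW2
  split_ifs with hs hi
  · rfl
  all_goals
    have h0 := sum_mpQ_eq_zero_imp hπ hk (le_antisymm (not_lt.1 hs)
      (Finset.sum_nonneg fun j _ => mpQ_nonneg hπ hk j x)) l
    simp [h0]

/-- The joint density of the current point and the proposals is integrable, and its first
marginal has density `π`. -/
lemma integrable_and_integral_mul_mpQ_zero {S : Type*} [MeasurableSpace S]
    {μ : Measure S} [SigmaFinite μ] {π : S → ℝ} (hπ_meas : Measurable π)
    (hπ_int : Integrable π μ) {M : ℕ} {k : (Fin M → S) → S → ℝ}
    (hk_meas : Measurable fun p : (Fin M → S) × S => k p.1 p.2)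
    (hk_nonneg : ∀ y x, 0 ≤ k y x)
    (hk_int : ∀ x : S, ∫ y, k y x ∂(Measure.pi fun _ : Fin M => μ) = 1)
    {h : S → ℝ} (hh_meas : Measurable h) (hh_bdd : ∃ C, ∀ x, |h x| ≤ C) :
    Integrable (fun x => h (x 0) * mpQ π k 0 x) (Measure.pi fun _ : Fin (M + 1) => μ) ∧
      ∫ x, h (x 0) * mpQ π k 0 x ∂(Measure.pi fun _ : Fin (M + 1) => μ)
        = ∫ x, h x * π x ∂μ := by
  obtain ⟨C, hC⟩ := hh_bdd
  have hhπ : Integrable (fun x => h x * π x) μ :=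
    hπ_int.bdd_mul hh_meas.aestronglyMeasurable (Filter.Eventually.of_forall hC)
  let F : S × (Fin M → S) → ℝ := fun p => h p.1 * π p.1 * k p.2 p.1
  have hF_meas : Measurable F :=
    ((hh_meas.comp measurable_fst).mul (hπ_meas.comp measurable_fst)).mul
      (hk_meas.comp measurable_swap)
  have hF : Integrable F (μ.prod (Measure.pi fun _ : Fin M => μ)) := by
    rw [integrable_prod_iff hF_meas.aestronglyMeasurable]
    constructor
    · refine Filter.Eventually.of_forall fun x => ?_
      have hkx : Integrable (fun y => k y x) (Measure.pi fun _ : Fin M => μ) :=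
        .of_integral_ne_zero (by rw [hk_int x]; exact one_ne_zero)
      exact hkx.const_mul (h x * π x)
    · simp only [F, norm_mul _ (k _ _), Real.norm_of_nonneg (hk_nonneg _ _), integral_const_mul,
        hk_int, mul_one]
      exact hhπ.norm
  have hmp := measurePreserving_piFinSuccAbove (fun _ : Fin (M + 1) => μ) 0
  have heq : (fun x : Fin (M + 1) → S => h (x 0) * mpQ π k 0 x)
      = F ∘ MeasurableEquiv.piFinSuccAbove (fun _ => S) 0 := by
    funext x
    exact (mul_assoc _ _ _).symm
  rw [heq]
  refine ⟨hmp.integrable_comp_of_integrable hF, ?_⟩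
  refine (hmp.integral_comp' F).trans ?_
  rw [integral_prod _ hF]
  simp only [F, integral_const_mul, hk_int, mul_one]

/-- Theorem 1, version 2: unbiasedness of locally weighted MCMC
with Barker-type weights.  For every bounded measurable `h : S → ℝ`,
`Σ_{i=0}^{M} ∫_{S^{M+1}} w_i(x) h(x_i) q₀(x) dμ^{⊗(M+1)}(x) = ∫_S h π dμ`:
if the current point `x₀` is distributed according to `π` and the proposals
are drawn from `k(·; x₀)`, the version 2 weighted estimator is unbiased. -/
theorem lwmcmc_version2_unbiased {S : Type*} [MeasurableSpace S]
    (μ : Measure S) [SigmaFinite μ]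
    (π : S → ℝ) (hπ_meas : Measurable π) (hπ_nonneg : ∀ x, 0 ≤ π x)
    (hπ_int : ∫ x, π x ∂μ = 1)
    (M : ℕ) (hM : 1 ≤ M)
    (k : (Fin M → S) → S → ℝ)
    (hk_meas : Measurable fun p : (Fin M → S) × S => k p.1 p.2)
    (hk_nonneg : ∀ y x, 0 ≤ k y x)
    (hk_int : ∀ x : S, ∫ y, k y x ∂(Measure.pi fun _ : Fin M => μ) = 1)
    (hk_symm : ∀ (σ : Equiv.Perm (Fin M)) (y : Fin M → S) (x : S), k (y ∘ σ) x = k y x)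
    (h : S → ℝ) (hh_meas : Measurable h) (hh_bdd : ∃ C, ∀ x, |h x| ≤ C) :
    ∑ i : Fin (M + 1),
        ∫ x, mpW2 π k i x * h (x i) * mpQ π k 0 x ∂(Measure.pi fun _ : Fin (M + 1) => μ)
      = ∫ x, h x * π x ∂μ := by
  have hπ_integrable : Integrable π μ :=
    .of_integral_ne_zero (by rw [hπ_int]; exact one_ne_zero)
  obtain ⟨hint, hval⟩ := integrable_and_integral_mul_mpQ_zero hπ_meas hπ_integrable hk_meas
    hk_nonneg hk_int hh_meas hh_bdd
  have hq_meas := measurable_mpQ hπ_meas hk_meas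
  let G : Fin (M + 1) → (Fin (M + 1) → S) → ℝ := fun i x =>
    mpQ π k i x / (∑ j, mpQ π k j x) * (h (x 0) * mpQ π k 0 x)
  have hG_int : ∀ i, Integrable (G i) (Measure.pi fun _ : Fin (M + 1) => μ) := by
    intro i
    refine hint.bdd_mul (c := 1) ?_ (Filter.Eventually.of_forall fun x => ?_)
    · exact ((hq_meas i).div
        (Finset.measurable_sum _ fun j _ => hq_meas j)).aestronglyMeasurable
    · have hnn := fun j => mpQ_nonneg hπ_nonneg hk_nonneg j x
      have hsum : 0 ≤ ∑ j, mpQ π k j x := Finset.sum_nonneg fun j _ => hnn j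
      rw [Real.norm_of_nonneg (div_nonneg (hnn i) hsum)]
      exact div_le_one_of_le₀
        (Finset.single_le_sum (fun j _ => hnn j) (Finset.mem_univ i)) hsum
  have hswap : ∀ i, ∫ x, mpW2 π k i x * h (x i) * mpQ π k 0 x
        ∂(Measure.pi fun _ : Fin (M + 1) => μ)
      = ∫ x, G i x ∂(Measure.pi fun _ : Fin (M + 1) => μ) := by
    intro i
    have hmp := measurePreserving_piCongrLeft (fun _ : Fin (M + 1) => μ) (Equiv.swap 0 i)
    rw [← hmp.integral_comp' (G i)]
    refine integral_congr_ae (Filter.Eventually.of_forall fun x => ?_)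
    have hx : MeasurableEquiv.piCongrLeft (fun _ => S) (Equiv.swap 0 i) x
        = fun a => x (Equiv.swap 0 i a) := by
      funext a
      have := MeasurableEquiv.piCongrLeft_apply_apply (β := fun _ => S) (Equiv.swap 0 i) x
        (Equiv.swap 0 i a)
      rwa [Equiv.swap_apply_self] at this
    have hsum : ∑ j, mpQ π k (Equiv.swap 0 i j) x = ∑ j, mpQ π k j x :=
      Equiv.sum_comp (Equiv.swap 0 i) fun j => mpQ π k j x
    simp only [G, hx, mpQ_comp_perm π hk_symm, hsum, Equiv.swap_apply_left,
      Equiv.swap_apply_right]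
    rw [mul_right_comm, mpW2_mul_mpQ hπ_nonneg hk_nonneg]
    ring
  rw [Finset.sum_congr rfl fun i _ => hswap i, ← integral_finsetSum _ fun i _ => hG_int i,
    ← hval]
  refine integral_congr_ae (Filter.Eventually.of_forall fun x => ?_)
  simp only [G]
  rw [← Finset.sum_mul, ← Finset.sum_div]
  by_cases hs : ∑ j, mpQ π k j x = 0
  · simp [sum_mpQ_eq_zero_imp hπ_nonneg hk_nonneg hs 0]
  · rw [div_self hs, one_mul]
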